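/- There exist constants c₁, c₂ > 0 and n₀ such that for every n ≥ n₀: every 3-uniform linear hypergraph on n vertices containing no copy of the Berge theta hypergraph Θ^B_{3,217} has at most c₂·n^{4/3} edges, and there exists a 3-uniform linear hypergraph on n vertices containing no copy of Θ^B_{3,217} with at least c₁·n^{4/3} edges. In other words, ex₃^{lin}(n, Θ^B_{3,217}) = Θ(n^{4/3}). -/

import Mathlib

/-- A 3-uniform hypergraph with edge set `E` contains a copy of the Berge theta
hypergraph `Θ^B_{3,t}`: there are pairwise distinct vertices `x, y, v₁^i, v₂^i`
and pairwise distinct edges `e₁^i, e₂^i, e₃^i` with `{x, v₁^i} ⊆ e₁^i`,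
`{v₁^i, v₂^i} ⊆ e₂^i` and `{v₂^i, y} ⊆ e₃^i` for every `i`. -/
def ContainsBergeTheta3 {α : Type*} (E : Set (Finset α)) (t : ℕ) : Prop :=
  ∃ (x y : α) (v1 v2 : Fin t → α) (e1 e2 e3 : Fin t → Finset α),
    Function.Injective (fun s : Fin 2 ⊕ Fin t ⊕ Fin t =>
      Sum.elim ![x, y] (Sum.elim v1 v2) s) ∧
    Function.Injective (Sum.elim e1 (Sum.elim e2 e3) :
      Fin t ⊕ Fin t ⊕ Fin t → Finset α) ∧
    (∀ i, e1 i ∈ E ∧ e2 i ∈ E ∧ e3 i ∈ E) ∧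
    (∀ i, x ∈ e1 i ∧ v1 i ∈ e1 i ∧ v1 i ∈ e2 i ∧ v2 i ∈ e2 i ∧
      v2 i ∈ e3 i ∧ y ∈ e3 i)

/-- `G` contains the theta graph consisting of `t` internally disjoint paths of length three
between two vertices. -/
def HasTheta3 {V : Type*} (G : SimpleGraph V) (t : ℕ) : Prop :=
  ∃ (x y : V) (v1 v2 : Fin t → V), x ≠ y ∧ Function.Injective v1 ∧ Function.Injective v2 ∧
    (∀ i j, v1 i ≠ v2 j) ∧ (∀ i, v1 i ≠ y) ∧ (∀ i, v2 i ≠ x) ∧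
    ∀ i, G.Adj x (v1 i) ∧ G.Adj (v1 i) (v2 i) ∧ G.Adj (v2 i) y

section Upper

open Finset

variable {V : Type*} {G : SimpleGraph V} {t : ℕ}

lemma exists_injective_fin_of_le_card {α : Type*} {s : Finset α} {t : ℕ} (h : t ≤ #s) :
    ∃ f : Fin t → α, Function.Injective f ∧ ∀ i, f i ∈ s := by
  obtain ⟨u, hu, hc⟩ := Finset.exists_subset_card_eq h
  refine ⟨fun i => (u.equivFin.symm (Fin.cast hc.symm i)).1, ?_, fun i => hu (Subtype.prop _)⟩
  intro i j hij
  simpa using Subtype.ext hij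

open Classical in
/-- In a graph without theta, the number of edges between a set `S` of neighbours of `p`
and a set `T` is linear in `#S + #T`. -/
lemma sum_card_adj_le (hG : ¬ HasTheta3 G t) (p : V) (S T : Finset V)
    (hS : ∀ s ∈ S, G.Adj p s) (hT : p ∉ T) :
    ∑ z ∈ T, #{s ∈ S | G.Adj z s} ≤ 2 * t * #T + t * #S := by
  set H := {z ∈ T | 2 * t < #{s ∈ S | G.Adj z s}} with hH
  have hfew : ∀ s ∈ S, #{z ∈ H | G.Adj z s} ≤ t := by
    intro s hs
    by_contra! hlt
    obtain ⟨z, hz, hzm⟩ := exists_injective_fin_of_le_card hlt.le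
    simp only [hH, mem_filter] at hzm
    let A : Fin t → Finset V := fun i => {s' ∈ S | G.Adj (z i) s'} \ insert s (univ.image z)
    have hA : ∀ i, t ≤ #(A i) := by
      intro i
      have h1 : #(insert s (univ.image z)) ≤ t + 1 := by
        refine (card_insert_le _ _).trans ?_
        have := (card_image_le (s := (univ : Finset (Fin t))) (f := z))
        simp at this
        omega
      have h2 := le_card_sdiff (insert s (univ.image z)) {s' ∈ S | G.Adj (z i) s'}
      have h3 := (hzm i).1.2
      simp only [A]
      omega
    obtain ⟨w, hw, hwm⟩ := (Finset.all_card_le_biUnion_card_iff_exists_injective A).1 (by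
      intro I
      rcases I.eq_empty_or_nonempty with rfl | ⟨i, hi⟩
      · simp
      · have h1 : #I ≤ t := by simpa using card_le_univ I
        exact h1.trans ((hA i).trans (card_le_card (subset_biUnion_of_mem A hi))))
    simp only [A, mem_sdiff, mem_filter, mem_insert, mem_image, mem_univ, true_and,
      not_or, not_exists] at hwm
    refine hG ⟨p, s, w, z, (hS s hs).ne, hw, hz, fun i j h => (hwm i).2.2 j h.symm,
      fun i => (hwm i).2.1, fun i h => hT (h ▸ (hzm i).1.1), fun i =>
      ⟨hS _ (hwm i).1.1, (hwm i).1.2.symm, (hzm i).2⟩⟩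
  have hsplit : ∑ z ∈ T, #{s ∈ S | G.Adj z s} ≤
      ∑ z ∈ T, 2 * t + ∑ z ∈ H, #{s ∈ S | G.Adj z s} := by
    rw [hH, sum_filter, ← sum_add_distrib]
    refine sum_le_sum fun z _ => ?_
    split_ifs <;> omega
  have hdc : ∑ z ∈ H, #{s ∈ S | G.Adj z s} = ∑ s ∈ S, #{z ∈ H | G.Adj z s} :=
    sum_card_bipartiteAbove_eq_sum_card_bipartiteBelow (fun z s => G.Adj z s)
  have h2 := sum_le_sum hfew
  simp only [sum_const, smul_eq_mul] at hsplit h2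
  rw [hdc] at hsplit
  linarith [mul_comm (#T) (2 * t), mul_comm (#S) t]

open Classical in
/-- If every vertex of a theta-free graph has degree at least `d`, then `d ^ 3 = O(#V)`. -/
lemma pow_three_le_of_minDegree [Fintype V] [Nonempty V] (hG : ¬ HasTheta3 G t) {d : ℕ}
    (ht : 0 < t) (hd : ∀ v, d ≤ #{w | G.Adj v w}) :
    d ^ 3 ≤ 512 * t ^ 3 * Fintype.card V := by
  have hn : 0 < Fintype.card V := Fintype.card_pos
  rcases lt_or_ge d (8 * t) with hdt | hdt
  · have : d ^ 3 ≤ (8 * t) ^ 3 := Nat.pow_le_pow_left hdt.le 3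
    nlinarith [Nat.mul_le_mul_left (512 * t ^ 3) hn]
  obtain ⟨x⟩ := ‹Nonempty V›
  set n := Fintype.card V with hn'
  set L1 : Finset V := {w | G.Adj x w} with hL1
  set L2 : Finset V := {v | v ≠ x ∧ ¬ G.Adj x v ∧ ∃ p, G.Adj x p ∧ G.Adj p v} with hL2
  set Z : Finset V := {v | v ≠ x ∧ ¬ G.Adj x v} with hZ
  have hdisj : Disjoint L1 L2 := by
    rw [disjoint_left]; intro a; simp only [hL1, hL2, mem_filter, mem_univ, true_and]; tauto
  have hL1d : d ≤ #L1 := hd x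
  have hL1n : #L1 ≤ n := card_le_univ _
  have hmem1 : ∀ s ∈ L1, G.Adj x s := by simp [hL1]
  -- expansion of the first neighbourhood
  have hA : (d - 1) * #L1 ≤ 2 * t * (#L1 + #L2) + t * #L1 := by
    have h1 := sum_card_adj_le hG x L1 (L1 ∪ L2) hmem1 (by simp [hL1, hL2])
    rw [card_union_of_disjoint hdisj] at h1
    refine le_trans ?_ h1
    have hdc : ∑ z ∈ L1 ∪ L2, #{s ∈ L1 | G.Adj z s} = ∑ s ∈ L1, #{z ∈ L1 ∪ L2 | G.Adj z s} :=
      sum_card_bipartiteAbove_eq_sum_card_bipartiteBelow (fun z s => G.Adj z s)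
    rw [hdc, mul_comm, ← smul_eq_mul, ← sum_const]
    refine sum_le_sum fun s hs => ?_
    have hsub : ({w | G.Adj s w} : Finset V).erase x ⊆ {z ∈ L1 ∪ L2 | G.Adj z s} := by
      intro w hw
      simp only [mem_erase, mem_filter, mem_univ, true_and, mem_union, hL1, hL2] at hw ⊢
      refine ⟨?_, hw.2.symm⟩
      by_cases h : G.Adj x w
      · exact Or.inl h
      · exact Or.inr ⟨hw.1, h, s, hmem1 s hs, hw.2⟩
    have h2 := card_le_card hsub
    have h3 := pred_card_le_card_erase (s := ({w | G.Adj s w} : Finset V)) (a := x)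
    have := hd s
    omega
  -- edges from the second neighbourhood back to the first
  have hB : ∑ z ∈ L2, #{s ∈ L1 | G.Adj z s} ≤ 2 * t * #L2 + t * #L1 :=
    sum_card_adj_le hG x L1 L2 hmem1 (by simp [hL2])
  have hpar : ∀ v : V, ∃ p, v ∈ L2 → G.Adj x p ∧ G.Adj p v := by
    intro v
    by_cases hv : v ∈ L2
    · obtain ⟨p, hp⟩ := (mem_filter.1 hv).2.2.2
      exact ⟨p, fun _ => hp⟩
    · exact ⟨v, fun h => absurd h hv⟩
  choose π hπ using hpar
  have hfew : ∀ y ∈ Z, #(({v ∈ L2 | G.Adj y v}).image π) ≤ t := by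
    intro y hy
    by_contra! hlt
    obtain ⟨w, hw, hwm⟩ := exists_injective_fin_of_le_card hlt.le
    simp only [mem_image, mem_filter] at hwm
    choose v hv hvw using hwm
    simp only [hZ, mem_filter, mem_univ, true_and] at hy
    have hxw : ∀ i, G.Adj x (w i) := fun i => hvw i ▸ (hπ _ (hv i).1).1
    have hv2 : ∀ i, v i ≠ x ∧ ¬ G.Adj x (v i) := fun i => by
      have := (hv i).1
      simp only [hL2, mem_filter, mem_univ, true_and] at this
      exact ⟨this.1, this.2.1⟩
    exact hG ⟨x, y, w, v, hy.1.symm, hw, fun i j h => hw (by rw [← hvw, ← hvw, h]),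
      fun i j h => (hv2 j).2 (h ▸ hxw i), fun i h => hy.2 (h ▸ hxw i), fun i => (hv2 i).1,
      fun i => ⟨hxw i, hvw i ▸ (hπ _ (hv i).1).2, (hv i).2.symm⟩⟩
  -- edges from the second neighbourhood outwards
  have hC : ∑ y ∈ Z, #{v ∈ L2 | G.Adj y v} ≤ 2 * t * (t * n) + t * #L2 := by
    let C : V → Finset V := fun p => {v ∈ L2 | π v = p}
    let Y : V → Finset V := fun p => {y ∈ Z | p ∈ ({v ∈ L2 | G.Adj y v}).image π}
    have hpartY : ∀ y ∈ Z, #{v ∈ L2 | G.Adj y v} =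
        ∑ p ∈ L1, if p ∈ ({v ∈ L2 | G.Adj y v}).image π then #{v ∈ C p | G.Adj y v} else 0 := by
      intro y hy
      rw [card_eq_sum_card_fiberwise (f := π) (t := L1)]
      · refine sum_congr rfl fun p _ => ?_
        split_ifs with h
        · congr 1; ext v; simp only [C, mem_filter]; tauto
        · rw [card_eq_zero, filter_eq_empty_iff]
          intro v hv hvp
          exact h (mem_image.2 ⟨v, hv, hvp⟩)
      · intro v hv
        have hv' := (mem_filter.1 (mem_coe.1 hv)).1
        simpa [hL1] using (hπ v hv').1
    have hstep : ∑ y ∈ Z, #{v ∈ L2 | G.Adj y v} = ∑ p ∈ L1, ∑ y ∈ Y p, #{v ∈ C p | G.Adj y v} := by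
      rw [sum_congr rfl hpartY, sum_comm]
      refine sum_congr rfl fun p _ => ?_
      rw [← sum_filter]
    have hpc : ∀ p ∈ L1, ∑ y ∈ Y p, #{v ∈ C p | G.Adj y v} ≤ 2 * t * #(Y p) + t * #(C p) := by
      intro p hp
      refine sum_card_adj_le hG p (C p) (Y p) ?_ ?_
      · intro s hs
        obtain ⟨h1, rfl⟩ := mem_filter.1 hs
        exact (hπ s h1).2
      · intro h
        have h1 := (mem_filter.1 h).1
        simp only [hZ, mem_filter] at h1
        exact h1.2.2 (hmem1 p hp)
    have hYsum : ∑ p ∈ L1, #(Y p) ≤ t * n := by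
      have hdc : ∑ p ∈ L1, #(Y p) =
          ∑ y ∈ Z, #{p ∈ L1 | p ∈ ({v ∈ L2 | G.Adj y v}).image π} :=
        sum_card_bipartiteAbove_eq_sum_card_bipartiteBelow
          (fun p y => p ∈ ({v ∈ L2 | G.Adj y v}).image π)
      rw [hdc]
      calc _ ≤ ∑ y ∈ Z, t := sum_le_sum fun y hy => (card_le_card (by
              intro p hp; exact (mem_filter.1 hp).2)).trans (hfew y hy)
        _ ≤ t * n := by
              rw [sum_const, smul_eq_mul, mul_comm]
              exact Nat.mul_le_mul_left _ (card_le_univ _)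
    have hCsum : ∑ p ∈ L1, #(C p) = #L2 := by
      refine (card_eq_sum_card_fiberwise (f := π) (t := L1) ?_).symm
      intro v hv
      simpa [hL1] using (hπ v (mem_coe.1 hv)).1
    rw [hstep]
    refine (sum_le_sum hpc).trans ?_
    rw [sum_add_distrib, ← mul_sum, ← mul_sum, hCsum]
    gcongr
  have hD : d * #L2 ≤ ∑ v ∈ L2, #{s ∈ L1 | G.Adj v s} + ∑ y ∈ Z, #{v ∈ L2 | G.Adj y v} := by
    have hdc : ∑ y ∈ Z, #{v ∈ L2 | G.Adj y v} = ∑ v ∈ L2, #{y ∈ Z | G.Adj y v} :=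
      sum_card_bipartiteAbove_eq_sum_card_bipartiteBelow (fun z s => G.Adj z s)
    rw [hdc, ← sum_add_distrib, mul_comm, ← smul_eq_mul, ← sum_const]
    refine sum_le_sum fun v hv => (hd v).trans ((card_le_card ?_).trans (card_union_le _ _))
    intro w hw
    simp only [mem_filter, mem_univ, true_and, mem_union, hL1, hZ, hL2] at hw hv ⊢
    by_cases h : G.Adj x w
    · exact Or.inl ⟨h, hw⟩
    · refine Or.inr ⟨⟨?_, h⟩, hw.symm⟩
      rintro rfl
      exact hv.2.1 hw.symm
  obtain ⟨e, rfl⟩ : ∃ e, d = e + 1 := ⟨d - 1, by omega⟩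
  simp only [Nat.add_sub_cancel] at hA
  have h1 : (e + 1) * #L1 ≤ 4 * t * #L2 := by nlinarith
  have h2 : (e + 1) * #L2 ≤ 6 * t ^ 2 * n := by nlinarith
  calc (e + 1) ^ 3 = (e + 1) * ((e + 1) * (e + 1)) := by ring
    _ ≤ (e + 1) * ((e + 1) * #L1) := by gcongr
    _ ≤ (e + 1) * (4 * t * #L2) := by gcongr
    _ = 4 * t * ((e + 1) * #L2) := by ring
    _ ≤ 4 * t * (6 * t ^ 2 * n) := by gcongr
    _ ≤ 512 * t ^ 3 * n := by nlinarith [Nat.zero_le (t ^ 3 * n)]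

open Classical in
/-- A graph with more than `k` edges per vertex has a nonempty induced subgraph of minimum degree
greater than `k`. Edges are counted as ordered pairs. -/
lemma exists_induced_minDegree (G : SimpleGraph V) (k : ℕ) (U : Finset V)
    (h : 2 * k * #U < ∑ v ∈ U, #{w ∈ U | G.Adj v w}) :
    ∃ W : Finset V, W.Nonempty ∧ W ⊆ U ∧ ∀ v ∈ W, k < #{w ∈ W | G.Adj v w} := by
  induction U using Finset.strongInduction with
  | H U ih =>
    by_cases hU : ∀ v ∈ U, k < #{w ∈ U | G.Adj v w}
    · refine ⟨U, ?_, Subset.rfl, hU⟩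
      rw [nonempty_iff_ne_empty]
      rintro rfl
      simp at h
    · push Not at hU
      obtain ⟨a, ha, hk⟩ := hU
      have hsum : ∑ v ∈ U, #{w ∈ U | G.Adj v w} =
          ∑ v ∈ U.erase a, #{w ∈ U.erase a | G.Adj v w} + 2 * #{w ∈ U | G.Adj a w} := by
        rw [← add_sum_erase _ _ ha]
        have h1 : ∀ v ∈ U.erase a, #{w ∈ U | G.Adj v w} =
            #{w ∈ U.erase a | G.Adj v w} + if G.Adj a v then 1 else 0 := by
          intro v _
          rw [filter_erase]
          split_ifs with hav
          · rw [card_erase_add_one]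
            exact mem_filter.2 ⟨ha, hav.symm⟩
          · rw [erase_eq_of_notMem, add_zero]
            exact fun h => hav (mem_filter.1 h).2.symm
        have h2 : #{w ∈ U.erase a | G.Adj a w} = #{w ∈ U | G.Adj a w} := by
          rw [filter_erase, erase_eq_of_notMem]
          simp
        rw [sum_congr rfl h1, sum_add_distrib, ← card_filter, h2]
        ring
      have hcard := card_erase_add_one ha
      obtain ⟨W, hW, hWU, hW'⟩ := ih (U.erase a) (erase_ssubset ha) (by
        rw [← hcard] at h
        nlinarith)
      exact ⟨W, hW, hWU.trans (erase_subset _ _), hW'⟩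

open Classical in
lemma ncard_edgeSet_le_of_not_hasTheta3 [Fintype V] (hG : ¬ HasTheta3 G t) (ht : 0 < t) {k : ℕ}
    (hk : 512 * t ^ 3 * Fintype.card V < (k + 1) ^ 3) :
    G.edgeSet.ncard ≤ k * Fintype.card V := by
  suffices h : ∑ v, #{w | G.Adj v w} ≤ 2 * k * Fintype.card V by
    have hdeg := G.sum_degrees_eq_twice_card_edges
    simp only [← SimpleGraph.card_neighborFinset_eq_degree,
      SimpleGraph.neighborFinset_eq_filter] at hdeg
    rw [← SimpleGraph.coe_edgeFinset, Set.ncard_coe_finset]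
    linarith
  by_contra! h
  obtain ⟨W, hW, -, hdeg⟩ := exists_induced_minDegree G k univ (by simpa using h)
  have : Nonempty W := hW.to_subtype
  have hG' : ¬ HasTheta3 (G.induce (W : Set V)) t := by
    rintro ⟨x, y, v1, v2, h1, h2, h3, h4, h5, h6, h7⟩
    refine hG ⟨x, y, fun i => v1 i, fun i => v2 i, fun h => h1 (Subtype.ext h),
      Subtype.val_injective.comp h2, Subtype.val_injective.comp h3,
      fun i j h => h4 i j (Subtype.ext h), fun i h => h5 i (Subtype.ext h),
      fun i h => h6 i (Subtype.ext h), fun i => by simpa using h7 i⟩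
  have hd : ∀ v : (W : Set V), k + 1 ≤ #{w | (G.induce (W : Set V)).Adj v w} := by
    intro v
    refine (Nat.succ_le_of_lt (hdeg v v.2)).trans ?_
    rw [← card_map (Function.Embedding.subtype (· ∈ (W : Set V)))]
    refine card_le_card fun w hw => ?_
    simp only [mem_filter] at hw
    simp only [mem_map, mem_filter, mem_univ, true_and]
    exact ⟨⟨w, hw.1⟩, by simpa using hw.2, rfl⟩
  have h1 := pow_three_le_of_minDegree hG' ht hd
  have h2 : Fintype.card (W : Set V) ≤ Fintype.card V := Fintype.card_subtype_le _
  have h3 := Nat.mul_le_mul_left (512 * t ^ 3) h2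
  omega

end Upper

section Algebra

open Finset

variable {F ι : Type*} [Field F]

lemma card_le_four_of_quartic {I : Finset ι} {X : ι → F} (hX : Set.InjOn X I)
    {c0 c1 c2 c3 c4 : F} (h4 : c4 ≠ 0)
    (h : ∀ i ∈ I, c4 * X i ^ 4 + c3 * X i ^ 3 + c2 * X i ^ 2 + c1 * X i + c0 = 0) :
    #I ≤ 4 := by
  classical
  set P : Polynomial F := .C c4 * .X ^ 4 + .C c3 * .X ^ 3 + .C c2 * .X ^ 2 + .C c1 * .X + .C c0
    with hP
  have hdeg : P.natDegree ≤ 4 := by rw [hP]; compute_degree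
  have hne : P ≠ 0 := by
    intro h0
    have : P.coeff 4 = c4 := by rw [hP]; simp
    rw [h0, Polynomial.coeff_zero] at this
    exact h4 this.symm
  rw [← card_image_of_injOn hX]
  refine (Polynomial.card_le_degree_of_subset_roots (p := P) ?_).trans hdeg
  intro x hx
  obtain ⟨i, hi, rfl⟩ := mem_image.1 (Finset.mem_def.2 hx)
  rw [Polynomial.mem_roots hne, Polynomial.IsRoot, hP]
  simpa using h i hi

lemma card_le_four_of_quadratic {I : Finset ι} {X : ι → F} (hX : Set.InjOn X I)
    {c0 c1 c2 : F} (h2 : c2 ≠ 0)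
    (h : ∀ i ∈ I, c2 * X i ^ 2 + c1 * X i + c0 = 0) : #I ≤ 4 :=
  card_le_four_of_quartic (c0 := 0) (c1 := 0) (c2 := c0) (c3 := c1) hX h2 fun i hi => by
    linear_combination X i ^ 2 * h i hi

variable {I : Finset ι} {X1 X2 X3 : ι → F} {w1 w2 w3 S1 S2 S3 : F}

lemma card_moment_le_of_sum_eq_zero (hF2 : (2 : F) ≠ 0) (hF3 : (3 : F) ≠ 0)
    (hw1 : w1 ≠ 0) (hw3 : w3 ≠ 0) (hw13 : w1 + w3 ≠ 0) (hW : w1 + w2 + w3 = 0)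
    (hX1 : Set.InjOn X1 I) (h12 : ∀ i ∈ I, X1 i ≠ X2 i)
    (h1 : ∀ i ∈ I, w1 * X1 i + w2 * X2 i + w3 * X3 i = S1)
    (h2 : ∀ i ∈ I, w1 * X1 i ^ 2 + w2 * X2 i ^ 2 + w3 * X3 i ^ 2 = S2)
    (h3 : ∀ i ∈ I, w1 * X1 i ^ 3 + w2 * X2 i ^ 3 + w3 * X3 i ^ 3 = S3) : #I ≤ 4 := by
  obtain rfl : w2 = -(w1 + w3) := by linear_combination hW
  have hz : ∀ i ∈ I, ∀ j ∈ I, X1 i - X2 i = X1 j - X2 j → X3 i - X2 i = X3 j - X2 j := by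
    intro i hi j hj hij
    apply mul_left_cancel₀ hw3
    linear_combination h1 i hi - h1 j hj - w1 * hij
  by_cases hS : S1 = 0
  · subst hS
    refine card_le_four_of_quadratic (X := fun i => X1 i - X2 i) (c2 := w1 * (w1 + w3)) (c1 := 0)
      (c0 := -w3 * S2) ?_ (mul_ne_zero hw1 hw13) ?_
    · intro i hi j hj hij
      simp only at hij
      have hij3 := hz i hi j hj hij
      have hQ : w1 * (X1 j - X2 j) ^ 2 + w3 * (X3 j - X2 j) ^ 2 ≠ 0 := by
        intro h0
        have : w1 * (w1 + w3) * (X1 j - X2 j) ^ 2 = 0 := by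
          linear_combination w3 * h0 + (w1 * (X1 j - X2 j) - w3 * (X3 j - X2 j)) * h1 j hj
        exact mul_ne_zero (mul_ne_zero hw1 hw13) (pow_ne_zero 2 (sub_ne_zero.2 (h12 j hj))) this
      have hx2 : X2 i = X2 j := by
        apply mul_left_cancel₀ (mul_ne_zero hF3 hQ)
        have e1 : X1 i = X2 i + (X1 j - X2 j) := by linear_combination hij
        have e3 : X3 i = X2 i + (X3 j - X2 j) := by linear_combination hij3
        have hi3 := h3 i hi
        have hi1 := h1 i hi
        rw [e1, e3] at hi3 hi1
        linear_combination hi3 - h3 j hj - 3 * (X2 i ^ 2) * hi1 + 3 * (X2 j ^ 2) * h1 j hj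
      exact hX1 hi hj (by linear_combination hij + hx2)
    · intro i hi
      have a1 := h1 i hi
      have a2 := h2 i hi
      linear_combination w3 * a2 + (w1 * (X1 i - X2 i) - w3 * (X3 i - X2 i) - 2 * w3 * X2 i) * a1
  · refine card_le_four_of_quartic (X := fun i => X1 i - X2 i)
      (c4 := -3 * (w1 * (w1 + w3)) ^ 2)
      (c3 := 4 * S1 * (w1 * w3 ^ 2 - w1 ^ 3) - 6 * (w1 * (w1 + w3)) * (-2 * S1 * w1))
      (c2 := 12 * S1 ^ 2 * w1 ^ 2 - 3 * ((-2 * S1 * w1) ^ 2 + 2 * (w1 * (w1 + w3)) * S1 ^ 2))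
      (c1 := -12 * S1 ^ 3 * w1 - 6 * (-2 * S1 * w1) * S1 ^ 2)
      (c0 := S1 ^ 4 + 3 * w3 ^ 2 * S2 ^ 2 - 4 * w3 ^ 2 * S1 * S3) ?_
      (mul_ne_zero (neg_ne_zero.2 hF3) (pow_ne_zero 2 (mul_ne_zero hw1 hw13))) ?_
    · intro i hi j hj hij
      simp only at hij
      have hij3 := hz i hi j hj hij
      have hx2 : X2 i = X2 j := by
        apply mul_left_cancel₀ (mul_ne_zero hF2 hS)
        have e1 : X1 i = X2 i + (X1 j - X2 j) := by linear_combination hij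
        have e3 : X3 i = X2 i + (X3 j - X2 j) := by linear_combination hij3
        have hi2 := h2 i hi
        have hi1 := h1 i hi
        rw [e1, e3] at hi2 hi1
        linear_combination hi2 - h2 j hj - 2 * X2 i * hi1 + 2 * X2 j * h1 j hj
      exact hX1 hi hj (by linear_combination hij + hx2)
    · intro i hi
      rw [← h1 i hi, ← h2 i hi, ← h3 i hi]
      ring

lemma card_moment_le_of_add_eq_zero (hw3 : w3 ≠ 0) (hw13 : w1 + w3 ≠ 0) (hw : w1 ≠ w3)
    (hw12 : w1 + w2 = 0) (hX3 : Set.InjOn X3 I)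
    (h1 : ∀ i ∈ I, w1 * X1 i + w2 * X2 i + w3 * X3 i = S1)
    (h2 : ∀ i ∈ I, w1 * X1 i ^ 2 + w2 * X2 i ^ 2 + w3 * X3 i ^ 2 = S2)
    (h3 : ∀ i ∈ I, w1 * X1 i ^ 3 + w2 * X2 i ^ 3 + w3 * X3 i ^ 3 = S3) : #I ≤ 4 := by
  obtain rfl : w2 = -w1 := by linear_combination hw12
  refine card_le_four_of_quartic (X := X3) (c4 := w3 ^ 2 * ((w1 - w3) * (w1 + w3)))
    (c3 := -4 * w1 ^ 2 * w3 * S1 + 4 * S1 * w3 ^ 3)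
    (c2 := 6 * w1 ^ 2 * w3 * S2 - 6 * S1 ^ 2 * w3 ^ 2)
    (c1 := -4 * w1 ^ 2 * w3 * S3 + 4 * S1 ^ 3 * w3)
    (c0 := w1 ^ 2 * (4 * S1 * S3 - 3 * S2 ^ 2) - S1 ^ 4) hX3
    (mul_ne_zero (pow_ne_zero 2 hw3) (mul_ne_zero (sub_ne_zero.2 hw) hw13)) ?_
  intro i hi
  rw [← h1 i hi, ← h2 i hi, ← h3 i hi]
  ring

lemma card_moment_le_of_alternating (hF2 : (2 : F) ≠ 0) (hF3 : (3 : F) ≠ 0)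
    (hw1 : w1 ≠ 0) (hw12 : w1 + w2 = 0) (hw23 : w2 + w3 = 0) (hX1 : Set.InjOn X1 I)
    (h12 : ∀ i ∈ I, X1 i ≠ X2 i) (h23 : ∀ i ∈ I, X2 i ≠ X3 i)
    (h1 : ∀ i ∈ I, w1 * X1 i + w2 * X2 i + w3 * X3 i = S1)
    (h2 : ∀ i ∈ I, w1 * X1 i ^ 2 + w2 * X2 i ^ 2 + w3 * X3 i ^ 2 = S2)
    (h3 : ∀ i ∈ I, w1 * X1 i ^ 3 + w2 * X2 i ^ 3 + w3 * X3 i ^ 3 = S3) : #I ≤ 4 := by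
  obtain rfl : w2 = -w1 := by linear_combination hw12
  obtain rfl : w3 = w1 := by linear_combination hw23
  rcases I.eq_empty_or_nonempty with rfl | ⟨j, hj⟩
  · simp
  have hq : ∀ i ∈ I, 2 * w3 ^ 2 * ((X1 i - X2 i) * (X3 i - X2 i)) = S1 ^ 2 - w3 * S2 := by
    intro i hi
    rw [← h1 i hi, ← h2 i hi]
    ring
  have hc : ∀ i ∈ I, 3 * w3 ^ 3 * ((X1 i - X2 i) * (X3 i - X2 i)) * (X1 i + X3 i) =
      S1 ^ 3 - w3 ^ 2 * S3 := by
    intro i hi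
    rw [← h1 i hi, ← h3 i hi]
    ring
  refine card_le_four_of_quadratic (X := X1) (c2 := 1) (c1 := -(X1 j + X3 j)) (c0 := X1 j * X3 j)
    hX1 one_ne_zero ?_
  intro i hi
  have hqq : (X1 i - X2 i) * (X3 i - X2 i) = (X1 j - X2 j) * (X3 j - X2 j) :=
    mul_left_cancel₀ (mul_ne_zero hF2 (pow_ne_zero 2 hw1)) ((hq i hi).trans (hq j hj).symm)
  have hs : X1 i + X3 i = X1 j + X3 j := by
    have := (hc i hi).trans (hc j hj).symm
    rw [hqq] at this
    exact mul_left_cancel₀ (mul_ne_zero (mul_ne_zero hF3 (pow_ne_zero 3 hw1))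
      (mul_ne_zero (sub_ne_zero.2 (h12 j hj)) (sub_ne_zero.2 (h23 j hj).symm))) this
  have hx2 : X2 i = X2 j := by
    apply mul_left_cancel₀ hw1
    linear_combination w3 * hs - h1 i hi + h1 j hj
  rw [hx2] at hqq
  linear_combination (X1 i - X2 j) * hs - hqq

/-- The slopes attached to the three vertex classes. -/
def classSlope (F : Type*) [Field F] : Fin 3 → F := ![0, 1, 3]

lemma classSlope_sub_ne_zero (hF2 : (2 : F) ≠ 0) (hF3 : (3 : F) ≠ 0) {i j : Fin 3}
    (hij : i ≠ j) : classSlope F i - classSlope F j ≠ 0 := by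
  fin_cases i <;> fin_cases j <;> simp [classSlope] at hij ⊢ <;> norm_num <;> assumption

/-- For fixed classes, few walks of length three through the moment curve join two vertices. -/
lemma card_moment_le (hF2 : (2 : F) ≠ 0) (hF3 : (3 : F) ≠ 0) (hF5 : (5 : F) ≠ 0)
    {a b c d : Fin 3} (hab : a ≠ b) (hbc : b ≠ c) (hcd : c ≠ d)
    (hX1 : Set.InjOn X1 I) (hX3 : Set.InjOn X3 I)
    (h12 : ∀ i ∈ I, X1 i ≠ X2 i) (h23 : ∀ i ∈ I, X2 i ≠ X3 i)
    (h1 : ∀ i ∈ I, (classSlope F a - classSlope F b) * X1 i + (classSlope F b - classSlope F c) * X2 i +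
      (classSlope F c - classSlope F d) * X3 i = S1)
    (h2 : ∀ i ∈ I, (classSlope F a - classSlope F b) * X1 i ^ 2 + (classSlope F b - classSlope F c) * X2 i ^ 2 +
      (classSlope F c - classSlope F d) * X3 i ^ 2 = S2)
    (h3 : ∀ i ∈ I, (classSlope F a - classSlope F b) * X1 i ^ 3 + (classSlope F b - classSlope F c) * X2 i ^ 3 +
      (classSlope F c - classSlope F d) * X3 i ^ 3 = S3) : #I ≤ 4 := by
  have hF4 : (4 : F) ≠ 0 := by
    have := mul_ne_zero hF2 hF2
    norm_num at this
    exact this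
  have hF6 : (6 : F) ≠ 0 := by
    have := mul_ne_zero hF2 hF3
    norm_num at this
    exact this
  have hne : ∀ i j : Fin 3, i ≠ j → classSlope F i - classSlope F j ≠ 0 := fun i j =>
    classSlope_sub_ne_zero hF2 hF3
  have hsum : classSlope F a - classSlope F b + (classSlope F c - classSlope F d) ≠ 0 := by
    clear h1 h2 h3
    fin_cases a <;> fin_cases b <;> simp at hab <;> fin_cases c <;> simp at hbc <;>
      fin_cases d <;> simp at hcd <;> simp [classSlope] <;> norm_num <;> assumption
  by_cases had : a = d
  · subst had
    exact card_moment_le_of_sum_eq_zero hF2 hF3 (hne _ _ hab) (hne _ _ hcd) hsum (by ring) hX1 h12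
      h1 h2 h3
  by_cases hac : a = c
  · subst hac
    by_cases hbd : b = d
    · subst hbd
      exact card_moment_le_of_alternating hF2 hF3 (hne _ _ hab) (by ring) (by ring) hX1 h12 h23
        h1 h2 h3
    · refine card_moment_le_of_add_eq_zero (hne _ _ hcd) hsum ?_ (by ring) hX3 h1 h2 h3
      intro h
      exact hne _ _ hbd (by linear_combination -h)
  · have hbd : b = d := by omega
    subst hbd
    refine card_moment_le_of_add_eq_zero (w1 := classSlope F c - classSlope F b)
      (w2 := classSlope F b - classSlope F c) (X1 := X3) (X2 := X2) (X3 := X1) (S1 := S1) (S2 := S2)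
      (S3 := S3) (hne _ _ hab) ?_ ?_ (by ring) hX1 ?_ ?_ ?_
    · rwa [add_comm]
    · intro h
      exact hne _ _ hac (by linear_combination -h)
    · intro i hi; linear_combination h1 i hi
    · intro i hi; linear_combination h2 i hi
    · intro i hi; linear_combination h3 i hi

end Algebra

section Construction

open Finset

variable {F V : Type*} [Field F]

/-- The vertex of class `i` on the edge with parameters `q`. -/
def curveVertex (i : Fin 3) (q : F × F × F × F) : Fin 3 × F × F × F :=
  (i, q.2.1 - classSlope F i * q.1, q.2.2.1 - classSlope F i * q.1 ^ 2,
    q.2.2.2 - classSlope F i * q.1 ^ 3)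

open Classical in
/-- The edge with parameters `q`, as a set of vertices in `V`. -/
noncomputable def curveEdge (φ : Fin 3 × F × F × F ↪ V) (q : F × F × F × F) : Finset V :=
  univ.image fun i => φ (curveVertex i q)

variable {φ : Fin 3 × F × F × F ↪ V} {q q' : F × F × F × F} {i j : Fin 3}

lemma mem_curveEdge {v : V} : v ∈ curveEdge φ q ↔ ∃ i, φ (curveVertex i q) = v := by
  simp [curveEdge]

lemma class_eq_of_curveVertex_eq (h : curveVertex i q = curveVertex j q') : i = j :=
  congrArg Prod.fst h

lemma curveVertex_eq_iff : curveVertex i q = curveVertex i q' ↔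
    q.2.1 - classSlope F i * q.1 = q'.2.1 - classSlope F i * q'.1 ∧
    q.2.2.1 - classSlope F i * q.1 ^ 2 = q'.2.2.1 - classSlope F i * q'.1 ^ 2 ∧
    q.2.2.2 - classSlope F i * q.1 ^ 3 = q'.2.2.2 - classSlope F i * q'.1 ^ 3 := by
  simp [curveVertex]

lemma param_eq_of_curveVertex_eq (h : curveVertex i q = curveVertex i q') (h1 : q.1 = q'.1) :
    q = q' := by
  obtain ⟨a, b, c⟩ := curveVertex_eq_iff.1 h
  rw [h1] at a b c
  refine Prod.ext h1 (Prod.ext ?_ (Prod.ext ?_ ?_))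
  · linear_combination a
  · linear_combination b
  · linear_combination c

lemma classSlope_injective (hF2 : (2 : F) ≠ 0) (hF3 : (3 : F) ≠ 0) :
    Function.Injective (classSlope F) := by
  intro i j h
  by_contra hij
  exact classSlope_sub_ne_zero hF2 hF3 hij (sub_eq_zero.2 h)

lemma param_eq_of_two_curveVertex_eq (hF2 : (2 : F) ≠ 0) (hF3 : (3 : F) ≠ 0) (hij : i ≠ j)
    (hi : curveVertex i q = curveVertex i q') (hj : curveVertex j q = curveVertex j q') :
    q = q' := by
  refine param_eq_of_curveVertex_eq hi ?_
  apply mul_left_cancel₀ (classSlope_sub_ne_zero hF2 hF3 hij)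
  linear_combination (curveVertex_eq_iff.1 hj).1 - (curveVertex_eq_iff.1 hi).1

lemma card_curveEdge : (curveEdge φ q).card = 3 := by
  classical
  have h : Function.Injective fun i => φ (curveVertex i q) := fun i j h =>
    class_eq_of_curveVertex_eq (φ.injective h)
  rw [curveEdge, card_image_of_injective _ h]
  simp

lemma curveVertex_eq_of_mem (h : φ (curveVertex i q) ∈ curveEdge φ q') :
    curveVertex i q = curveVertex i q' := by
  obtain ⟨j, hj⟩ := mem_curveEdge.1 h
  have h := φ.injective hj
  obtain rfl := class_eq_of_curveVertex_eq h
  exact h.symm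

lemma curveEdge_injective (hF2 : (2 : F) ≠ 0) (hF3 : (3 : F) ≠ 0) :
    Function.Injective (curveEdge φ) := by
  intro q q' h
  have hm : ∀ i, curveVertex i q = curveVertex i q' := fun i =>
    curveVertex_eq_of_mem (φ := φ) (h ▸ mem_curveEdge.2 ⟨i, rfl⟩)
  exact param_eq_of_two_curveVertex_eq hF2 hF3 (zero_ne_one (α := Fin 3)) (hm 0) (hm 1)

lemma card_curveEdge_inter_le [DecidableEq V] (hF2 : (2 : F) ≠ 0) (hF3 : (3 : F) ≠ 0)
    (h : curveEdge φ q ≠ curveEdge φ q') : (curveEdge φ q ∩ curveEdge φ q').card ≤ 1 := by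
  rw [card_le_one]
  intro u hu v hv
  rw [mem_inter] at hu hv
  obtain ⟨i, rfl⟩ := mem_curveEdge.1 hu.1
  obtain ⟨j, rfl⟩ := mem_curveEdge.1 hv.1
  by_cases hij : i = j
  · rw [hij]
  · exact absurd (congrArg _ (param_eq_of_two_curveVertex_eq hF2 hF3 hij
      (curveVertex_eq_of_mem hu.2) (curveVertex_eq_of_mem hv.2))) h

lemma not_containsBergeTheta3_range_curveEdge (hF2 : (2 : F) ≠ 0) (hF3 : (3 : F) ≠ 0)
    (hF5 : (5 : F) ≠ 0) {t : ℕ} (ht : 36 < t) :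
    ¬ ContainsBergeTheta3 (Set.range (curveEdge φ)) t := by
  rintro ⟨x, y, v1, v2, e1, e2, e3, hv, he, hE, hinc⟩
  choose q1 hq1 using fun i => (hE i).1
  choose q2 hq2 using fun i => (hE i).2.1
  choose q3 hq3 using fun i => (hE i).2.2
  obtain ⟨i₀⟩ : Nonempty (Fin t) := ⟨⟨0, by omega⟩⟩
  obtain ⟨⟨a, P⟩, rfl⟩ : ∃ P, φ P = x := by
    have h := (hinc i₀).1
    rw [← hq1, mem_curveEdge] at h
    exact ⟨_, h.choose_spec⟩
  obtain ⟨⟨d, Q⟩, rfl⟩ : ∃ Q, φ Q = y := by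
    have h := (hinc i₀).2.2.2.2.2
    rw [← hq3, mem_curveEdge] at h
    exact ⟨_, h.choose_spec⟩
  have key : ∀ i, ∃ bc : Fin 3 × Fin 3, a ≠ bc.1 ∧ bc.1 ≠ bc.2 ∧ bc.2 ≠ d ∧
      curveVertex a (q1 i) = (a, P) ∧ curveVertex bc.1 (q1 i) = curveVertex bc.1 (q2 i) ∧
      curveVertex bc.2 (q2 i) = curveVertex bc.2 (q3 i) ∧ curveVertex d (q3 i) = (d, Q) := by
    intro i
    have h := hinc i
    have hx1 : φ (a, P) ≠ v1 i := fun h => by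
      simpa using @hv (Sum.inl 0) (Sum.inr (Sum.inl i)) h
    have h12 : v1 i ≠ v2 i := fun h => by
      simpa using @hv (Sum.inr (Sum.inl i)) (Sum.inr (Sum.inr i)) h
    have h2y : v2 i ≠ φ (d, Q) := fun h => by
      simpa using @hv (Sum.inr (Sum.inr i)) (Sum.inl 1) h
    rw [← hq1, ← hq2, ← hq3] at h
    obtain ⟨m1, m2, m3, m4, m5, m6⟩ := h
    obtain ⟨a', ha⟩ := mem_curveEdge.1 m1
    have ha := φ.injective ha
    obtain rfl : a' = a := congrArg Prod.fst ha
    obtain ⟨d', hd⟩ := mem_curveEdge.1 m6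
    have hd := φ.injective hd
    obtain rfl : d' = d := congrArg Prod.fst hd
    obtain ⟨b, hb⟩ := mem_curveEdge.1 m2
    obtain ⟨c, hc⟩ := mem_curveEdge.1 m4
    rw [← ha, ← hb] at hx1
    rw [← hb] at m3
    have hb2 := curveVertex_eq_of_mem m3
    rw [← hb, ← hc, hb2] at h12
    rw [← hc] at m5
    have hc2 := curveVertex_eq_of_mem m5
    rw [← hc, ← hd, hc2] at h2y
    exact ⟨(b, c), fun h => hx1 (h ▸ rfl), fun h => h12 (by simp only at h; rw [h]),
      fun h => h2y (by simp only at h; rw [h]), ha, hb2, hc2, hd⟩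
  choose bc hab hbc hcd h1 h2 h3 h4 using key
  have hq1_inj : Function.Injective fun i => (q1 i).1 := by
    intro i j h
    have := param_eq_of_curveVertex_eq ((h1 i).trans (h1 j).symm) h
    simpa using @he (Sum.inl i) (Sum.inl j) (by simp [← hq1, this])
  have hq3_inj : Function.Injective fun i => (q3 i).1 := by
    intro i j h
    have := param_eq_of_curveVertex_eq ((h4 i).trans (h4 j).symm) h
    simpa using @he (Sum.inr (Sum.inr i)) (Sum.inr (Sum.inr j)) (by simp [← hq3, this])
  have hq12 : ∀ i, (q1 i).1 ≠ (q2 i).1 := by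
    intro i h
    have := param_eq_of_curveVertex_eq (h2 i) h
    simpa using @he (Sum.inl i) (Sum.inr (Sum.inl i)) (by simp [← hq1, ← hq2, this])
  have hq23 : ∀ i, (q2 i).1 ≠ (q3 i).1 := by
    intro i h
    have := param_eq_of_curveVertex_eq (h3 i) h
    simpa using @he (Sum.inr (Sum.inl i)) (Sum.inr (Sum.inr i)) (by simp [← hq2, ← hq3, this])
  obtain ⟨⟨b, c⟩, hlt⟩ := Fintype.exists_lt_card_fiber_of_mul_lt_card bc (n := 4) (by simpa using ht)
  have hbc' : ∀ i ∈ ({i | bc i = (b, c)} : Finset (Fin t)), bc i = (b, c) := fun i hi =>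
    (mem_filter.1 hi).2
  obtain ⟨i₁, hi₁⟩ := card_pos.1 (Nat.zero_lt_of_lt hlt)
  have hab' := hab i₁
  have hbc'' := hbc i₁
  have hcd' := hcd i₁
  rw [hbc' i₁ hi₁] at hab' hbc'' hcd'
  refine absurd (card_moment_le hF2 hF3 hF5 hab' hbc'' hcd' hq1_inj.injOn hq3_inj.injOn
    (fun i _ => hq12 i) (fun i _ => hq23 i) (S1 := Q.1 - P.1) (S2 := Q.2.1 - P.2.1)
    (S3 := Q.2.2 - P.2.2) ?_ ?_ ?_) (not_le.2 hlt)
  all_goals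
    intro i hi
    have e1 := h1 i
    have e2 := h2 i
    have e3 := h3 i
    have e4 := h4 i
    rw [hbc' i hi] at e2 e3
    rw [curveVertex_eq_iff] at e2 e3
    simp only [curveVertex, Prod.ext_iff, true_and] at e1 e4
  · linear_combination e4.1 - e1.1 + e2.1 + e3.1
  · linear_combination e4.2.1 - e1.2.1 + e2.2.1 + e3.2.1
  · linear_combination e4.2.2 - e1.2.2 + e2.2.2 + e3.2.2

end Construction

section Main

open Finset

/-- Choosing a pair of vertices in each edge transfers theta-freeness from a linear hypergraph to a
graph with as many edges. -/
lemma ncard_le_of_not_containsBergeTheta3 {V : Type*} [Fintype V] [DecidableEq V] {t k : ℕ}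
    (ht : 0 < t) {E : Set (Finset V)} (hE : ∀ e ∈ E, e.card = 3)
    (hlin : ∀ e1 ∈ E, ∀ e2 ∈ E, e1 ≠ e2 → (e1 ∩ e2).card ≤ 1) (hth : ¬ ContainsBergeTheta3 E t)
    (hk : 512 * t ^ 3 * Fintype.card V < (k + 1) ^ 3) :
    E.ncard ≤ k * Fintype.card V := by
  classical
  rcases isEmpty_or_nonempty V with hV | ⟨⟨v₀⟩⟩
  · have : E = ∅ := Set.eq_empty_of_forall_notMem fun e he => by
      simpa [e.eq_empty_of_isEmpty] using hE e he
    simp [this]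
  have hpair : ∀ e : Finset V, ∃ p : V × V, e ∈ E → p.1 ∈ e ∧ p.2 ∈ e ∧ p.1 ≠ p.2 := by
    intro e
    by_cases he : e ∈ E
    · obtain ⟨a, ha, b, hb, hab⟩ := one_lt_card.1 (by rw [hE e he]; norm_num : 1 < e.card)
      exact ⟨(a, b), fun _ => ⟨ha, hb, hab⟩⟩
    · exact ⟨(v₀, v₀), fun h => absurd h he⟩
  choose f hf using hpair
  let g : Finset V → Sym2 V := fun e => s((f e).1, (f e).2)
  let G : SimpleGraph V := SimpleGraph.fromEdgeSet (g '' E)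
  have hmem : ∀ e ∈ E, ∀ u v, g e = s(u, v) → u ∈ e ∧ v ∈ e := by
    intro e he u v h
    rcases Sym2.eq_iff.1 h with ⟨rfl, rfl⟩ | ⟨rfl, rfl⟩
    · exact ⟨(hf e he).1, (hf e he).2.1⟩
    · exact ⟨(hf e he).2.1, (hf e he).1⟩
  have hadj : ∀ u v, G.Adj u v → ∃ e ∈ E, g e = s(u, v) := fun u v h => by
    simpa [G] using h.1
  have hG : ¬ HasTheta3 G t := by
    rintro ⟨x, y, v1, v2, hxy, hv1, hv2, hv12, hv1y, hv2x, hpath⟩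
    have hxv1 : ∀ i, x ≠ v1 i := fun i => (hpath i).1.ne
    have hv2y : ∀ i, v2 i ≠ y := fun i => (hpath i).2.2.ne
    choose e1 he1 hg1 using fun i => hadj _ _ (hpath i).1
    choose e2 he2 hg2 using fun i => hadj _ _ (hpath i).2.1
    choose e3 he3 hg3 using fun i => hadj _ _ (hpath i).2.2
    refine hth ⟨x, y, v1, v2, e1, e2, e3, ?_, ?_, fun i => ⟨he1 i, he2 i, he3 i⟩, fun i =>
      ⟨(hmem _ (he1 i) _ _ (hg1 i)).1, (hmem _ (he1 i) _ _ (hg1 i)).2,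
        (hmem _ (he2 i) _ _ (hg2 i)).1, (hmem _ (he2 i) _ _ (hg2 i)).2,
        (hmem _ (he3 i) _ _ (hg3 i)).1, (hmem _ (he3 i) _ _ (hg3 i)).2⟩⟩
    · refine Function.Injective.sumElim ?_ (hv1.sumElim hv2 hv12) ?_
      · intro i j h
        fin_cases i <;> fin_cases j <;> simp_all
      · intro i j
        rcases j with j | j <;> fin_cases i
        · exact hxv1 j
        · exact (hv1y j).symm
        · exact (hv2x j).symm
        · exact (hv2y j).symm
    · refine Function.Injective.sumElim ?_ (Function.Injective.sumElim ?_ ?_ ?_) ?_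
      · intro i j h
        have := (hg1 i).symm.trans ((congrArg g h).trans (hg1 j))
        rcases Sym2.eq_iff.1 this with h | h
        · exact hv1 h.2
        · exact absurd h.1 (hxv1 _)
      · intro i j h
        have := (hg2 i).symm.trans ((congrArg g h).trans (hg2 j))
        rcases Sym2.eq_iff.1 this with h | h
        · exact hv1 h.1
        · exact absurd h.1 (hv12 _ _)
      · intro i j h
        have := (hg3 i).symm.trans ((congrArg g h).trans (hg3 j))
        rcases Sym2.eq_iff.1 this with h | h
        · exact hv2 h.1
        · exact absurd h.1 (hv2y _)
      · intro i j h
        have := (hg2 i).symm.trans ((congrArg g h).trans (hg3 j))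
        rcases Sym2.eq_iff.1 this with h | h
        · exact hv12 _ _ h.1
        · exact hv1y _ h.1
      · intro i j
        rcases j with j | j <;> intro h
        · have := (hg1 i).symm.trans ((congrArg g h).trans (hg2 j))
          rcases Sym2.eq_iff.1 this with h | h
          · exact hxv1 _ h.1
          · exact hv2x _ h.1.symm
        · have := (hg1 i).symm.trans ((congrArg g h).trans (hg3 j))
          rcases Sym2.eq_iff.1 this with h | h
          · exact hv2x _ h.1.symm
          · exact hxy h.1
  have hginj : Set.InjOn g E := by
    intro e he e' he' h
    by_contra hne
    have h1 := hmem e' he' _ _ h.symm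
    have h2 := hf e he
    exact h2.2.2 (card_le_one.1 (hlin e he e' he' hne) _ (mem_inter.2 ⟨h2.1, h1.1⟩) _
      (mem_inter.2 ⟨h2.2.1, h1.2⟩))
  have hcard : E.ncard ≤ G.edgeSet.ncard := by
    rw [← hginj.ncard_image]
    refine Set.ncard_le_ncard ?_ (Set.toFinite _)
    rintro _ ⟨e, he, rfl⟩
    rw [SimpleGraph.edgeSet_fromEdgeSet]
    refine ⟨⟨e, he, rfl⟩, ?_⟩
    simpa [g] using (hf e he).2.2
  exact hcard.trans (ncard_edgeSet_le_of_not_hasTheta3 hG ht hk)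

lemma exists_not_containsBergeTheta3 {n p : ℕ} (hp : p.Prime) (hp5 : 5 < p)
    (hn : 3 * p ^ 3 ≤ n) {t : ℕ} (ht : 36 < t) :
    ∃ E : Set (Finset (Fin n)), (∀ e ∈ E, e.card = 3) ∧
      (∀ e1 ∈ E, ∀ e2 ∈ E, e1 ≠ e2 → (e1 ∩ e2).card ≤ 1) ∧
      ¬ ContainsBergeTheta3 E t ∧ E.ncard = p ^ 4 := by
  have := Fact.mk hp
  have hne : ∀ m : ℕ, 0 < m → m < p → ((m : ℕ) : ZMod p) ≠ 0 := fun m h0 hm h =>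
    absurd (Nat.le_of_dvd h0 ((ZMod.natCast_eq_zero_iff m p).1 h)) (by omega)
  have h2 : (2 : ZMod p) ≠ 0 := by exact_mod_cast hne 2 (by omega) (by omega)
  have h3 : (3 : ZMod p) ≠ 0 := by exact_mod_cast hne 3 (by omega) (by omega)
  have h5 : (5 : ZMod p) ≠ 0 := by exact_mod_cast hne 5 (by omega) (by omega)
  obtain ⟨φ⟩ : Nonempty (Fin 3 × ZMod p × ZMod p × ZMod p ↪ Fin n) := by
    apply Function.Embedding.nonempty_of_card_le
    simp only [Fintype.card_prod, Fintype.card_fin, ZMod.card]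
    linarith
  refine ⟨Set.range (curveEdge φ), ?_, ?_, not_containsBergeTheta3_range_curveEdge h2 h3 h5 ht, ?_⟩
  · rintro _ ⟨q, rfl⟩
    exact card_curveEdge
  · rintro _ ⟨q, rfl⟩ _ ⟨q', rfl⟩ h
    exact card_curveEdge_inter_le h2 h3 h
  · rw [← Set.image_univ, Set.ncard_image_of_injective _ (curveEdge_injective h2 h3),
      Set.ncard_univ]
    simp only [Nat.card_eq_fintype_card, Fintype.card_prod, ZMod.card]
    ring

theorem stmt_19 :
    ∃ c1 c2 : ℝ, 0 < c1 ∧ 0 < c2 ∧ ∃ n0 : ℕ, ∀ n : ℕ, n0 ≤ n →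
      (∀ E : Set (Finset (Fin n)), (∀ e ∈ E, e.card = 3) →
        (∀ e1 ∈ E, ∀ e2 ∈ E, e1 ≠ e2 → (e1 ∩ e2).card ≤ 1) →
        ¬ ContainsBergeTheta3 E 217 →
        (E.ncard : ℝ) ≤ c2 * (n : ℝ) ^ ((4 : ℝ) / 3)) ∧
      (∃ E : Set (Finset (Fin n)), (∀ e ∈ E, e.card = 3) ∧
        (∀ e1 ∈ E, ∀ e2 ∈ E, e1 ≠ e2 → (e1 ∩ e2).card ≤ 1) ∧
        ¬ ContainsBergeTheta3 E 217 ∧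
        c1 * (n : ℝ) ^ ((4 : ℝ) / 3) ≤ (E.ncard : ℝ)) := by
  refine ⟨1 / 8 ^ 4, 8 * 217, by norm_num, by norm_num, 8 ^ 4, fun n hn => ?_⟩
  have hn0 : (0 : ℝ) ≤ n := Nat.cast_nonneg n
  set r : ℝ := (n : ℝ) ^ ((1 : ℝ) / 3) with hr
  have hr0 : 0 ≤ r := Real.rpow_nonneg hn0 _
  have hr3 : r ^ 3 = n := by
    rw [hr, ← Real.rpow_natCast, ← Real.rpow_mul hn0]
    norm_num
  have hr4 : (n : ℝ) ^ ((4 : ℝ) / 3) = r ^ 4 := by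
    rw [hr, ← Real.rpow_natCast, ← Real.rpow_mul hn0]
    norm_num
  rw [hr4]
  have hr16 : 16 ≤ r := by
    have h : (16 : ℝ) ^ 3 ≤ r ^ 3 := by
      rw [hr3]
      have : ((8 ^ 4 : ℕ) : ℝ) ≤ n := by exact_mod_cast hn
      norm_num at this ⊢
      exact this
    exact le_of_pow_le_pow_left₀ (by norm_num) hr0 h
  constructor
  · intro E hE hlin hth
    set k : ℕ := ⌊8 * 217 * r⌋₊ with hk
    have hk1 : (k : ℝ) ≤ 8 * 217 * r := Nat.floor_le (by positivity)
    have hk2 : 8 * 217 * r < k + 1 := Nat.lt_floor_add_one _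
    have hk3 : 512 * 217 ^ 3 * Fintype.card (Fin n) < (k + 1) ^ 3 := by
      rw [Fintype.card_fin]
      have h := pow_lt_pow_left₀ hk2 (by positivity) (three_ne_zero)
      have h' : (512 * 217 ^ 3 * n : ℝ) < (k + 1) ^ 3 := by
        rw [← hr3]
        refine lt_of_eq_of_lt ?_ h
        ring
      exact_mod_cast h'
    have h := ncard_le_of_not_containsBergeTheta3 (by norm_num) hE hlin hth hk3
    rw [Fintype.card_fin] at h
    calc (E.ncard : ℝ) ≤ k * n := by exact_mod_cast h
      _ ≤ 8 * 217 * r * r ^ 3 := by rw [hr3]; gcongr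
      _ = 8 * 217 * r ^ 4 := by ring
  · set k : ℕ := ⌊r / 3⌋₊ with hk
    have hk1 : (k : ℝ) ≤ r / 3 := Nat.floor_le (by positivity)
    have hk2 : r / 3 < k + 1 := Nat.lt_floor_add_one _
    have hk5 : 5 ≤ k := Nat.le_floor (by push_cast; linarith)
    obtain ⟨p, hp, hkp, hpk⟩ := Nat.exists_prime_lt_and_le_two_mul k (by omega)
    have hpr : (p : ℝ) ≤ 2 * k := by exact_mod_cast hpk
    have hnp : 3 * p ^ 3 ≤ n := by
      have : (3 * p ^ 3 : ℝ) ≤ n := by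
        rw [← hr3]
        calc (3 * p ^ 3 : ℝ) ≤ 3 * (2 * (r / 3)) ^ 3 := by gcongr; linarith
          _ = 24 / 27 * r ^ 3 := by ring
          _ ≤ r ^ 3 := by nlinarith [pow_nonneg hr0 3]
      exact_mod_cast this
    obtain ⟨E, h1, h2, h3, h4⟩ := exists_not_containsBergeTheta3 (t := 217) hp (by omega) hnp
      (by norm_num)
    refine ⟨E, h1, h2, h3, ?_⟩
    rw [h4]
    have hkp' : (k + 1 : ℝ) ≤ p := by exact_mod_cast hkp
    have h8 : r / 8 ≤ p := by linarith
    calc 1 / 8 ^ 4 * r ^ 4 = (r / 8) ^ 4 := by ring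
      _ ≤ (p : ℝ) ^ 4 := by gcongr
      _ = ((p ^ 4 : ℕ) : ℝ) := by push_cast; rfl

end Main
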